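/- arXiv:1512.00695 — 9 statements merged into one kernel-verified Lean document; each statement's English description precedes it below -/
import Mathlib

section
/- Fix real parameters Δ_x, Δ_y > 1, κ_x > 0, κ_y > 0 and integers n_x, n_y ≥ 1, and let F(x) = (1 + (κ_y f_y(x))^{n_x})/(1 + Δ_x (κ_y f_y(x))^{n_x}) with f_y(x) = (1 + x^{n_y})/(1 + Δ_y x^{n_y}). Then there exists x* with 0 < x* < κ_x such that x* = κ_x F(x*); consequently the bistable switch system always has at least one steady state. -/
/-- There always exists x* with 0 < x* < κ_x and x* = κ_x F(x*); the bistable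
switch system always has at least one steady state. -/
theorem exists_steady_state (Δx Δy κx κy : ℝ) (hΔx : 1 < Δx) (hΔy : 1 < Δy)
    (hκx : 0 < κx) (hκy : 0 < κy) (nx ny : ℕ) (hnx : 1 ≤ nx) (hny : 1 ≤ ny) :
    let fy : ℝ → ℝ := fun x => (1 + x ^ ny) / (1 + Δy * x ^ ny)
    let F : ℝ → ℝ := fun x => (1 + (κy * fy x) ^ nx) / (1 + Δx * (κy * fy x) ^ nx)
    ∃ xs : ℝ, 0 < xs ∧ xs < κx ∧ xs = κx * F xs := by
  intro fy F
  have hΔx0 : 0 < Δx := by linarith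
  have hΔy0 : 0 < Δy := by linarith
  have hden : ∀ x : ℝ, 0 ≤ x → 0 < 1 + Δy * x ^ ny := fun x hx => by positivity
  have hfy : ∀ x : ℝ, 0 ≤ x → 0 < fy x := fun x hx => by
    show 0 < (1 + x ^ ny) / (1 + Δy * x ^ ny)
    positivity
  have hp : ∀ x : ℝ, 0 ≤ x → 0 < (κy * fy x) ^ nx := fun x hx =>
    pow_pos (mul_pos hκy (hfy x hx)) _
  have hden2 : ∀ x : ℝ, 0 ≤ x → 0 < 1 + Δx * (κy * fy x) ^ nx := fun x hx => by
    have := mul_pos hΔx0 (hp x hx)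
    linarith
  have hF0 : ∀ x : ℝ, 0 ≤ x → 0 < F x := fun x hx =>
    div_pos (by linarith [hp x hx]) (hden2 x hx)
  have hF1 : ∀ x : ℝ, 0 ≤ x → F x < 1 := fun x hx => by
    show _ / _ < (1 : ℝ)
    rw [div_lt_one (hden2 x hx)]
    nlinarith [hp x hx]
  have cfy : ContinuousOn fy (Set.Icc 0 κx) :=
    ContinuousOn.div (by fun_prop) (by fun_prop) fun x hx => (hden x hx.1).ne'
  have cF : ContinuousOn F (Set.Icc 0 κx) :=
    ContinuousOn.div (by fun_prop) (by fun_prop) fun x hx => (hden2 x hx.1).ne'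
  have cg : ContinuousOn (fun x => x - κx * F x) (Set.Icc 0 κx) := by fun_prop
  have h0 := mul_pos hκx (hF0 0 le_rfl)
  have h1 := mul_lt_mul_of_pos_left (hF1 κx hκx.le) hκx
  obtain ⟨x, hx, hxe⟩ := intermediate_value_Ioo hκx.le cg
    (show (0 : ℝ) ∈ Set.Ioo _ _ from ⟨by simpa using h0, by linarith⟩)
  exact ⟨x, hx.1, hx.2, sub_eq_zero.mp hxe⟩
end

section
/- Let W : [0, T] → ℝ^4 be a differentiable solution of the system dx1/dt = γ_{x1}(κ_x f_x(y2) − x1), dx2/dt = γ_{x2}(x1 − x2), dy1/dt = γ_{y1}(κ_y f_y(x2) − y1), dy2/dt = γ_{y2}(y1 − y2), with all γ's and κ_x, κ_y positive. If all four components of W(0) are nonnegative, then all four components of W(t) are nonnegative for every t ∈ [0, T]. -/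
lemma aux_nonneg {T γ a b : ℝ} {u g : ℝ → ℝ} (hγ : 0 < γ) (ha : 0 ≤ a) (hb : b ≤ T)
    (hu : ∀ t ∈ Set.Icc (0 : ℝ) T, HasDerivWithinAt u (γ * (g t - u t)) (Set.Icc (0 : ℝ) T) t)
    (hg : ∀ t ∈ Set.Icc a b, 0 ≤ g t) (hua : 0 ≤ u a) : ∀ t ∈ Set.Icc a b, 0 ≤ u t := by
  have hsub : Set.Icc a b ⊆ Set.Icc 0 T := Set.Icc_subset_Icc ha hb
  have hd : ∀ t ∈ Set.Icc a b, HasDerivWithinAt (fun t => Real.exp (γ * t) * u t)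
      (Real.exp (γ * t) * (γ * g t)) (Set.Icc a b) t := by
    intro t ht
    have h1 : HasDerivAt (fun t : ℝ => Real.exp (γ * t)) (Real.exp (γ * t) * (γ * 1)) t :=
      ((hasDerivAt_id t).const_mul γ).exp
    have h2 := h1.hasDerivWithinAt.mul ((hu t (hsub ht)).mono hsub)
    refine h2.congr_deriv ?_
    ring
  have hm : MonotoneOn (fun t => Real.exp (γ * t) * u t) (Set.Icc a b) := by
    refine monotoneOn_of_hasDerivWithinAt_nonneg (convex_Icc a b)
      (fun t ht => (hd t ht).continuousWithinAt)
      (fun t ht => (hd t (interior_subset ht)).mono interior_subset) ?_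
    intro t ht
    have := hg t (interior_subset ht)
    positivity
  intro t ht
  have h := hm (Set.left_mem_Icc.2 (ht.1.trans ht.2)) ht ht.1
  have h3 : 0 ≤ Real.exp (γ * t) * u t := le_trans (by positivity) h
  exact nonneg_of_mul_nonneg_right h3 (Real.exp_pos _)

lemma aux_event {T Δ κ x : ℝ} {n : ℕ} {y : ℝ → ℝ} (hΔ : 1 < Δ) (hκ : 0 < κ)
    (hy : ContinuousOn y (Set.Icc 0 T)) (hx0 : 0 ≤ x) (hxT : x < T) (hyx : 0 ≤ y x) :
    ∀ᶠ t in nhdsWithin x (Set.Ici x), 0 ≤ κ * ((1 + (y t) ^ n) / (1 + Δ * (y t) ^ n)) := by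
  have hc : ContinuousWithinAt (fun t => Δ * (y t) ^ n) (Set.Ici x) x := by
    have h1 : ContinuousWithinAt y (Set.Icc x T) x :=
      (hy x ⟨hx0, hxT.le⟩).mono (Set.Icc_subset_Icc hx0 le_rfl)
    have h2 : ContinuousWithinAt y (Set.Ici x) x := by
      rwa [ContinuousWithinAt, nhdsWithin_Icc_eq_nhdsGE hxT] at h1
    exact continuousWithinAt_const.mul (h2.pow n)
  have hlt : (-1 : ℝ) < Δ * (y x) ^ n := by
    have : 0 ≤ Δ * (y x) ^ n := by positivity
    linarith
  filter_upwards [hc.eventually (lt_mem_nhds hlt)] with t ht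
  have : -1 < (y t) ^ n := by
    by_contra! hcon
    nlinarith
  have h1 : 0 ≤ 1 + (y t) ^ n := by linarith
  have h2 : 0 ≤ 1 + Δ * (y t) ^ n := by linarith
  positivity

/-- If a differentiable solution of the four-dimensional bistable switch system
on [0, T] has all four components nonnegative at t = 0, then all four components remain
nonnegative for every t ∈ [0, T]: the flow preserves the nonnegative orthant. -/
theorem flow_preserves_nonneg_orthant (Δx Δy κx κy γx1 γx2 γy1 γy2 T : ℝ)
    (hΔx : 1 < Δx) (hΔy : 1 < Δy) (hκx : 0 < κx) (hκy : 0 < κy)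
    (hγx1 : 0 < γx1) (hγx2 : 0 < γx2) (hγy1 : 0 < γy1) (hγy2 : 0 < γy2)
    (nx ny : ℕ) (hnx : 1 ≤ nx) (hny : 1 ≤ ny) (hT : 0 ≤ T)
    (x1 x2 y1 y2 : ℝ → ℝ)
    (hx1 : ∀ t ∈ Set.Icc (0 : ℝ) T, HasDerivWithinAt x1
      (γx1 * (κx * ((1 + (y2 t) ^ nx) / (1 + Δx * (y2 t) ^ nx)) - x1 t))
      (Set.Icc (0 : ℝ) T) t)
    (hx2 : ∀ t ∈ Set.Icc (0 : ℝ) T, HasDerivWithinAt x2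
      (γx2 * (x1 t - x2 t)) (Set.Icc (0 : ℝ) T) t)
    (hy1 : ∀ t ∈ Set.Icc (0 : ℝ) T, HasDerivWithinAt y1
      (γy1 * (κy * ((1 + (x2 t) ^ ny) / (1 + Δy * (x2 t) ^ ny)) - y1 t))
      (Set.Icc (0 : ℝ) T) t)
    (hy2 : ∀ t ∈ Set.Icc (0 : ℝ) T, HasDerivWithinAt y2
      (γy2 * (y1 t - y2 t)) (Set.Icc (0 : ℝ) T) t)
    (h0 : 0 ≤ x1 0 ∧ 0 ≤ x2 0 ∧ 0 ≤ y1 0 ∧ 0 ≤ y2 0) :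
    ∀ t ∈ Set.Icc (0 : ℝ) T, 0 ≤ x1 t ∧ 0 ≤ x2 t ∧ 0 ≤ y1 t ∧ 0 ≤ y2 t := by
  have cx1 : ContinuousOn x1 (Set.Icc 0 T) := fun t ht => (hx1 t ht).continuousWithinAt
  have cx2 : ContinuousOn x2 (Set.Icc 0 T) := fun t ht => (hx2 t ht).continuousWithinAt
  have cy1 : ContinuousOn y1 (Set.Icc 0 T) := fun t ht => (hy1 t ht).continuousWithinAt
  have cy2 : ContinuousOn y2 (Set.Icc 0 T) := fun t ht => (hy2 t ht).continuousWithinAt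
  have key : Set.Icc 0 T ⊆ {t | 0 ≤ x1 t ∧ 0 ≤ x2 t ∧ 0 ≤ y1 t ∧ 0 ≤ y2 t} := by
    apply IsClosed.Icc_subset_of_forall_mem_nhdsWithin
    · have hcl : ∀ u : ℝ → ℝ, ContinuousOn u (Set.Icc 0 T) →
          IsClosed (Set.Icc 0 T ∩ u ⁻¹' Set.Ici 0) := fun u hu =>
        hu.preimage_isClosed_of_isClosed isClosed_Icc isClosed_Ici
      have := (((hcl x1 cx1).inter (hcl x2 cx2)).inter (hcl y1 cy1)).inter (hcl y2 cy2)
      convert this using 1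
      ext t
      simp only [Set.mem_inter_iff, Set.mem_setOf_eq, Set.mem_preimage, Set.mem_Ici]
      tauto
    · exact h0
    · rintro x ⟨⟨p1, p2, p3, p4⟩, hx0, hxT⟩
      have e1 := aux_event (n := nx) hΔx hκx cy2 hx0 hxT p4
      have e2 := aux_event (n := ny) hΔy hκy cx2 hx0 hxT p2
      have e3 : ∀ᶠ t in nhdsWithin x (Set.Ici x), t ∈ Set.Icc x T := Icc_mem_nhdsGE hxT
      obtain ⟨b, hb, hsub⟩ := mem_nhdsGE_iff_exists_Icc_subset.1 ((e1.and e2).and e3)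
      have hb' : x < b := hb
      have hbT : b ≤ T := (hsub (Set.right_mem_Icc.2 hb'.le)).2.2
      have q1 := aux_nonneg hγx1 hx0 hbT hx1 (fun t ht => (hsub ht).1.1) p1
      have q2 := aux_nonneg hγx2 hx0 hbT hx2 q1 p2
      have q3 := aux_nonneg hγy1 hx0 hbT hy1 (fun t ht => (hsub ht).1.2) p3
      have q4 := aux_nonneg hγy2 hx0 hbT hy2 q3 p4
      filter_upwards [Ioc_mem_nhdsGT hb'] with t ht
      have ht' := Set.Ioc_subset_Icc_self ht
      exact ⟨q1 t ht', q2 t ht', q3 t ht', q4 t ht'⟩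
  exact key
end

section
/- Let I_x = [κ_x/Δ_x, κ_x] and I_y = [κ_y/Δ_y, κ_y] and let B = {(x1, x2, y1, y2) : x1, x2 ∈ I_x, y1, y2 ∈ I_y}. On the boundary of B the vector field of the system dx1/dt = γ_{x1}(κ_x f_x(y2) − x1), dx2/dt = γ_{x2}(x1 − x2), dy1/dt = γ_{y1}(κ_y f_y(x2) − y1), dy2/dt = γ_{y2}(y1 − y2) points into B; precisely, for any point of B: if x1 = κ_x/Δ_x then dx1/dt ≥ 0 and if x1 = κ_x then dx1/dt ≤ 0; if x2 = κ_x/Δ_x then dx2/dt ≥ 0 and if x2 = κ_x then dx2/dt ≤ 0; and the analogous four inequalities hold for y1 and y2. -/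
/-- Bounds for the regulation function, scaled by `κ`. -/
theorem hill_bounds (D k t : ℝ) (n : ℕ) (hD : 1 < D) (hk : 0 < k) (ht : 0 ≤ t) :
    k / D ≤ k * ((1 + t ^ n) / (1 + D * t ^ n)) ∧
      k * ((1 + t ^ n) / (1 + D * t ^ n)) ≤ k := by
  have hp : 0 ≤ t ^ n := pow_nonneg ht n
  have hD0 : 0 < D := by linarith
  have hd : 0 < 1 + D * t ^ n := by positivity
  constructor
  · rw [← mul_div_assoc, div_le_div_iff₀ hD0 hd]
    nlinarith [mul_pos hk (sub_pos.2 hD)]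
  · apply mul_le_of_le_one_right hk.le
    rw [div_le_one hd]
    nlinarith

/-- On the boundary of the attracting box
B = [κ_x/Δ_x, κ_x]² × [κ_y/Δ_y, κ_y]², the vector field of the bistable switch system
points into B. -/
theorem vector_field_points_into_box (Δx Δy κx κy γx1 γx2 γy1 γy2 : ℝ)
    (hΔx : 1 < Δx) (hΔy : 1 < Δy) (hκx : 0 < κx) (hκy : 0 < κy)
    (hγx1 : 0 < γx1) (hγx2 : 0 < γx2) (hγy1 : 0 < γy1) (hγy2 : 0 < γy2)
    (nx ny : ℕ) (hnx : 1 ≤ nx) (hny : 1 ≤ ny) (x1 x2 y1 y2 : ℝ)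
    (hx1 : x1 ∈ Set.Icc (κx / Δx) κx) (hx2 : x2 ∈ Set.Icc (κx / Δx) κx)
    (hy1 : y1 ∈ Set.Icc (κy / Δy) κy) (hy2 : y2 ∈ Set.Icc (κy / Δy) κy) :
    let fx : ℝ → ℝ := fun y => (1 + y ^ nx) / (1 + Δx * y ^ nx)
    let fy : ℝ → ℝ := fun x => (1 + x ^ ny) / (1 + Δy * x ^ ny)
    (x1 = κx / Δx → 0 ≤ γx1 * (κx * fx y2 - x1)) ∧
    (x1 = κx → γx1 * (κx * fx y2 - x1) ≤ 0) ∧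
    (x2 = κx / Δx → 0 ≤ γx2 * (x1 - x2)) ∧
    (x2 = κx → γx2 * (x1 - x2) ≤ 0) ∧
    (y1 = κy / Δy → 0 ≤ γy1 * (κy * fy x2 - y1)) ∧
    (y1 = κy → γy1 * (κy * fy x2 - y1) ≤ 0) ∧
    (y2 = κy / Δy → 0 ≤ γy2 * (y1 - y2)) ∧
    (y2 = κy → γy2 * (y1 - y2) ≤ 0) := by
  intro fx fy
  have hy0 : 0 ≤ y2 := le_trans (div_nonneg hκy.le (by linarith)) hy2.1
  have hx0 : 0 ≤ x2 := le_trans (div_nonneg hκx.le (by linarith)) hx2.1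
  obtain ⟨ax, bx⟩ := hill_bounds Δx κx y2 nx hΔx hκx hy0
  obtain ⟨ay, cy⟩ := hill_bounds Δy κy x2 ny hΔy hκy hx0
  refine ⟨fun h => ?_, fun h => ?_, fun h => ?_, fun h => ?_, fun h => ?_, fun h => ?_,
    fun h => ?_, fun h => ?_⟩
  · exact mul_nonneg hγx1.le (sub_nonneg.2 (h.le.trans ax))
  · exact mul_nonpos_of_nonneg_of_nonpos hγx1.le (sub_nonpos.2 (bx.trans h.ge))
  · exact mul_nonneg hγx2.le (sub_nonneg.2 (h.le.trans hx1.1))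
  · exact mul_nonpos_of_nonneg_of_nonpos hγx2.le (sub_nonpos.2 (hx1.2.trans h.ge))
  · exact mul_nonneg hγy1.le (sub_nonneg.2 (h.le.trans ay))
  · exact mul_nonpos_of_nonneg_of_nonpos hγy1.le (sub_nonpos.2 (cy.trans h.ge))
  · exact mul_nonneg hγy2.le (sub_nonneg.2 (h.le.trans hy1.1))
  · exact mul_nonpos_of_nonneg_of_nonpos hγy2.le (sub_nonpos.2 (hy1.2.trans h.ge))
end

section
/- Let Δ_y > 1 be real and n_y ≥ 1 an integer, and define R(x) = −n_y(Δ_y − 1) x^{n_y} / ((1 + x^{n_y})(1 + Δ_y x^{n_y})) for x > 0. Then for all x > 0, R(x) ≥ R_min := −n_y(Δ_y − 1)/(1 + √Δ_y)², with equality if and only if x = Δ_y^{−1/(2 n_y)}. -/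
/-- For Δ_y > 1 and n_y ≥ 1, the function
R(x) = −n_y(Δ_y − 1) x^{n_y} / ((1 + x^{n_y})(1 + Δ_y x^{n_y})) on (0, ∞) satisfies
R(x) ≥ R_min = −n_y(Δ_y − 1)/(1 + √Δ_y)², with equality iff x = Δ_y^{−1/(2 n_y)}. -/
theorem R_min_characterization (Δy : ℝ) (hΔy : 1 < Δy) (ny : ℕ) (hny : 1 ≤ ny) :
    ∀ x : ℝ, 0 < x →
      (-((ny : ℝ) * (Δy - 1) * x ^ ny) / ((1 + x ^ ny) * (1 + Δy * x ^ ny)) ≥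
        -((ny : ℝ) * (Δy - 1)) / (1 + Real.sqrt Δy) ^ 2) ∧
      (-((ny : ℝ) * (Δy - 1) * x ^ ny) / ((1 + x ^ ny) * (1 + Δy * x ^ ny)) =
        -((ny : ℝ) * (Δy - 1)) / (1 + Real.sqrt Δy) ^ 2 ↔
        x = Δy ^ (-(1 / (2 * (ny : ℝ))))) := by
  intro x hx
  have hD : 0 < Δy := by linarith
  have hn : (0 : ℝ) < ny := by exact_mod_cast hny
  have hn0 : ny ≠ 0 := by omega
  have ht : 0 < x ^ ny := pow_pos hx ny
  have hs : 0 < Real.sqrt Δy := Real.sqrt_pos.mpr hD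
  have hss : Real.sqrt Δy ^ 2 = Δy := Real.sq_sqrt hD.le
  have hpow : (Δy ^ (-(1 / (2 * (ny : ℝ))))) ^ ny = (Real.sqrt Δy)⁻¹ := by
    rw [← Real.rpow_natCast, ← Real.rpow_mul hD.le, Real.sqrt_eq_rpow, ← Real.rpow_neg hD.le]
    congr 1
    field_simp
  have hx_iff : x = Δy ^ (-(1 / (2 * (ny : ℝ)))) ↔ 1 - Real.sqrt Δy * x ^ ny = 0 := by
    rw [← pow_left_inj₀ hx.le (Real.rpow_nonneg hD.le _) hn0, hpow,
      ← mul_eq_one_iff_eq_inv₀ hs.ne', mul_comm, sub_eq_zero, eq_comm]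
  have hc : 0 < (ny : ℝ) * (Δy - 1) := mul_pos hn (by linarith)
  have hden : 0 < (1 + x ^ ny) * (1 + Δy * x ^ ny) * (1 + Real.sqrt Δy) ^ 2 := by positivity
  have key : -((ny : ℝ) * (Δy - 1) * x ^ ny) / ((1 + x ^ ny) * (1 + Δy * x ^ ny)) -
      -((ny : ℝ) * (Δy - 1)) / (1 + Real.sqrt Δy) ^ 2 =
      (ny : ℝ) * (Δy - 1) * (1 - Real.sqrt Δy * x ^ ny) ^ 2 /
        ((1 + x ^ ny) * (1 + Δy * x ^ ny) * (1 + Real.sqrt Δy) ^ 2) := by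
    rw [div_sub_div _ _ (by positivity) (by positivity)]
    congr 1
    linear_combination (-((ny : ℝ) * (Δy - 1)) * (x ^ ny + (x ^ ny) ^ 2)) * hss
  constructor
  · rw [ge_iff_le, ← sub_nonneg, key]
    positivity
  · rw [← sub_eq_zero, key, hx_iff, div_eq_zero_iff, mul_eq_zero, sq_eq_zero_iff]
    simp only [hden.ne', hc.ne', false_or, or_false]
end

section
/- Let Δ_x, Δ_y > 1 be real and n_x, n_y ≥ 1 integers, and define L(y) = −(1 + y^{n_x})(1 + Δ_x y^{n_x})/(n_x (Δ_x − 1) y^{n_x}) and R(x) = −n_y(Δ_y − 1) x^{n_y} / ((1 + x^{n_y})(1 + Δ_y x^{n_y})) for x, y > 0. If there exist x > 0 and y > 0 with L(y) = R(x), then n_x n_y ≥ (1 + √Δ_x)²(1 + √Δ_y)²/((Δ_x − 1)(Δ_y − 1)), and moreover (1 + √Δ_x)²(1 + √Δ_y)²/((Δ_x − 1)(Δ_y − 1)) ≥ 1. -/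
lemma hill_aux (D u : ℝ) (hD : 1 < D) :
    (1 + Real.sqrt D) ^ 2 * u ≤ (1 + u) * (1 + D * u) := by
  have hs : Real.sqrt D ^ 2 = D := Real.sq_sqrt (by linarith)
  have key : (1 + u) * (1 + Real.sqrt D ^ 2 * u) - (1 + Real.sqrt D) ^ 2 * u
      = (1 - Real.sqrt D * u) ^ 2 := by ring
  rw [hs] at key
  linarith [sq_nonneg (1 - Real.sqrt D * u)]

lemma sqrt_aux (D : ℝ) (hD : 1 < D) : D - 1 ≤ (1 + Real.sqrt D) ^ 2 := by
  have hs : Real.sqrt D ^ 2 = D := Real.sq_sqrt (by linarith)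
  nlinarith [Real.sqrt_nonneg D]

/-- If the tangency condition L(y) = R(x) has a solution with x, y > 0, then
n_x n_y ≥ (1 + √Δ_x)²(1 + √Δ_y)²/((Δ_x − 1)(Δ_y − 1)), and this bound is itself ≥ 1:
a necessary condition for bistability. -/
theorem necessary_condition_for_bistability (Δx Δy : ℝ) (hΔx : 1 < Δx) (hΔy : 1 < Δy)
    (nx ny : ℕ) (hnx : 1 ≤ nx) (hny : 1 ≤ ny)
    (h : ∃ x : ℝ, 0 < x ∧ ∃ y : ℝ, 0 < y ∧
      -((1 + y ^ nx) * (1 + Δx * y ^ nx)) / ((nx : ℝ) * (Δx - 1) * y ^ nx) =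
      -((ny : ℝ) * (Δy - 1) * x ^ ny) / ((1 + x ^ ny) * (1 + Δy * x ^ ny))) :
    (nx : ℝ) * (ny : ℝ) ≥
      (1 + Real.sqrt Δx) ^ 2 * (1 + Real.sqrt Δy) ^ 2 / ((Δx - 1) * (Δy - 1)) ∧
    (1 + Real.sqrt Δx) ^ 2 * (1 + Real.sqrt Δy) ^ 2 / ((Δx - 1) * (Δy - 1)) ≥ 1 := by
  have hx1 : 0 < Δx - 1 := by linarith
  have hy1 : 0 < Δy - 1 := by linarith
  constructor
  · obtain ⟨x, hx, y, hy, h⟩ := h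
    have hu : 0 < y ^ nx := pow_pos hy _
    have hv : 0 < x ^ ny := pow_pos hx _
    generalize y ^ nx = u at h hu
    generalize x ^ ny = v at h hv
    have hnx' : (0 : ℝ) < nx := by exact_mod_cast hnx
    have hny' : (0 : ℝ) < ny := by exact_mod_cast hny
    have hB : 0 < (1 + v) * (1 + Δy * v) := by positivity
    rw [div_eq_div_iff (by positivity) hB.ne'] at h
    have h1 := hill_aux Δx u hΔx
    have h2 := hill_aux Δy v hΔy
    have h3 := mul_le_mul h1 h2 (by positivity) (le_trans (by positivity) h1)
    rw [ge_iff_le, div_le_iff₀ (by positivity)]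
    refine le_of_mul_le_mul_right ?_ (mul_pos hu hv)
    linarith
  · rw [ge_iff_le, le_div_iff₀ (by positivity), one_mul]
    exact mul_le_mul (sqrt_aux Δx hΔx) (sqrt_aux Δy hΔy) hy1.le (by positivity)
end

section
/- Let Δ_x, Δ_y > 1 be real, n_x, n_y ≥ 1 integers, f_x(y) = (1 + y^{n_x})/(1 + Δ_x y^{n_x}) and f_y(x) = (1 + x^{n_y})/(1 + Δ_y x^{n_y}), and let L(y) = −(1 + y^{n_x})(1 + Δ_x y^{n_x})/(n_x (Δ_x − 1) y^{n_x}) and R(x) = −n_y(Δ_y − 1) x^{n_y} / ((1 + x^{n_y})(1 + Δ_y x^{n_y})). Suppose x > 0 and y > 0 satisfy L(y) = R(x), and set κ_x = x / f_x(y) and κ_y = y / f_y(x). Then x = κ_x f_x(y), y = κ_y f_y(x), and κ_x κ_y f_x′(y) f_y′(x) = 1; that is, (x, y) is a steady state at which the two nullclines are tangent. -/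
lemma hill_elasticity (D : ℝ) (hD : 1 < D) (n : ℕ) (hn : 1 ≤ n) (t : ℝ) (ht : 0 < t) :
    t * deriv (fun s : ℝ => (1 + s ^ n) / (1 + D * s ^ n)) t =
      -((n : ℝ) * (D - 1) * t ^ n) / ((1 + t ^ n) * (1 + D * t ^ n)) *
        ((1 + t ^ n) / (1 + D * t ^ n)) := by
  have hp : 0 < t ^ n := pow_pos ht n
  have h1 : 0 < 1 + t ^ n := by positivity
  have h2 : 0 < 1 + D * t ^ n := by
    have : 0 < D := by linarith
    positivity
  have hd := ((hasDerivAt_pow n t).const_add 1).fun_div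
    (((hasDerivAt_pow n t).const_mul D).const_add 1) h2.ne'
  rw [hd.deriv]
  obtain ⟨m, rfl⟩ : ∃ m, n = m + 1 := ⟨n - 1, by omega⟩
  simp only [Nat.add_sub_cancel]
  field_simp
  ring

/-- If x, y > 0 satisfy the tangency condition L(y) = R(x) and we set
κ_x = x / f_x(y) and κ_y = y / f_y(x), then x = κ_x f_x(y), y = κ_y f_y(x), and
κ_x κ_y f_x′(y) f_y′(x) = 1: (x, y) is a steady state at which the nullclines are tangent. -/
theorem tangency_gives_tangent_steady_state (Δx Δy : ℝ) (hΔx : 1 < Δx) (hΔy : 1 < Δy)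
    (nx ny : ℕ) (hnx : 1 ≤ nx) (hny : 1 ≤ ny) (x y : ℝ) (hx : 0 < x) (hy : 0 < y)
    (hLR : -((1 + y ^ nx) * (1 + Δx * y ^ nx)) / ((nx : ℝ) * (Δx - 1) * y ^ nx) =
      -((ny : ℝ) * (Δy - 1) * x ^ ny) / ((1 + x ^ ny) * (1 + Δy * x ^ ny))) :
    let fx : ℝ → ℝ := fun t => (1 + t ^ nx) / (1 + Δx * t ^ nx)
    let fy : ℝ → ℝ := fun t => (1 + t ^ ny) / (1 + Δy * t ^ ny)
    let κx : ℝ := x / fx y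
    let κy : ℝ := y / fy x
    x = κx * fx y ∧ y = κy * fy x ∧ κx * κy * deriv fx y * deriv fy x = 1 := by
  intro fx fy κx κy
  have hyp : 0 < y ^ nx := pow_pos hy nx
  have hxp : 0 < x ^ ny := pow_pos hx ny
  have hDx : 0 < Δx := by linarith
  have hDy : 0 < Δy := by linarith
  have hfx : 0 < fx y := by simp only [fx]; positivity
  have hfy : 0 < fy x := by simp only [fy]; positivity
  have hX : y * deriv fx y = _ * fx y := hill_elasticity Δx hΔx nx hnx y hy
  have hY : x * deriv fy x = _ * fy x := hill_elasticity Δy hΔy ny hny x hx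
  refine ⟨by simp only [κx]; field_simp, by simp only [κy]; field_simp, ?_⟩
  have e : κx * κy * deriv fx y * deriv fy x
      = (y * deriv fx y) * (x * deriv fy x) / (fx y * fy x) := by
    simp only [κx, κy]
    field_simp
  rw [e, hX, hY, ← hLR]
  have hn : (0 : ℝ) < nx := by exact_mod_cast hnx
  have hd : 0 < Δx - 1 := by linarith
  have h1 : 0 < 1 + y ^ nx := by positivity
  have h2 : 0 < 1 + Δx * y ^ nx := by positivity
  generalize fx y = A at *
  generalize fy x = B at *
  field_simp
end

section
/- Let γ_1, γ_2, γ_3, γ_4 > 0 be real and let c be a real number with 0 ≤ c < γ_1 γ_2 γ_3 γ_4. Then every complex number λ satisfying (λ + γ_1)(λ + γ_2)(λ + γ_3)(λ + γ_4) = c has strictly negative real part. -/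
/-- If γ_1, γ_2, γ_3, γ_4 > 0 and 0 ≤ c < γ_1 γ_2 γ_3 γ_4, then every complex
root λ of (λ + γ_1)(λ + γ_2)(λ + γ_3)(λ + γ_4) = c has strictly negative real part. -/
theorem eigenvalues_negative_real_part (γ1 γ2 γ3 γ4 c : ℝ)
    (hγ1 : 0 < γ1) (hγ2 : 0 < γ2) (hγ3 : 0 < γ3) (hγ4 : 0 < γ4)
    (hc0 : 0 ≤ c) (hc : c < γ1 * γ2 * γ3 * γ4) :
    ∀ lam : ℂ,
      (lam + (γ1 : ℂ)) * (lam + (γ2 : ℂ)) * (lam + (γ3 : ℂ)) * (lam + (γ4 : ℂ)) = (c : ℂ) →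
      lam.re < 0 := by
  intro lam h
  by_contra hn
  have hre : 0 ≤ lam.re := not_lt.mp hn
  have key : ∀ g : ℝ, g ≤ ‖lam + (g : ℂ)‖ := by
    intro g
    have h1 := Complex.re_le_norm (lam + (g : ℂ))
    simp only [Complex.add_re, Complex.ofReal_re] at h1
    linarith
  have hnorm := congrArg norm h
  rw [norm_mul, norm_mul, norm_mul, Complex.norm_real, Real.norm_of_nonneg hc0] at hnorm
  have hle : γ1 * γ2 * γ3 * γ4 ≤
      ‖lam + (γ1 : ℂ)‖ * ‖lam + (γ2 : ℂ)‖ * ‖lam + (γ3 : ℂ)‖ * ‖lam + (γ4 : ℂ)‖ := by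
    gcongr <;> apply key
  linarith
end

section
/- Fix real parameters Δ_x, Δ_y > 1, κ_y > 0, κ_b > 0, b > 0, C > 0 and integers n_x, n_y ≥ 1. Define f_y(x) = (1 + x^{n_y})/(1 + Δ_y x^{n_y}), F(x) = (1 + (κ_y f_y(x))^{n_x})/(1 + Δ_x (κ_y f_y(x))^{n_x}) for x ≥ 0, h(w) = (1/b) e^{−w/b} for w ≥ 0, and u_*(x) = (C/x) e^{−x/b} exp(κ_b ∫_1^x F(z)/z dz) for x > 0. Then u_* is differentiable on (0, ∞) and for every x > 0 it satisfies the stationary bursting equation −(d/dx)(x u_*(x)) = −κ_b F(x) u_*(x) + κ_b ∫_0^x F(z) u_*(z) h(x − z) dz, the integral on the right being finite. -/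
open Real MeasureTheory intervalIntegral

lemma gen_burst (F : ℝ → ℝ) (c κb b C : ℝ) (hF : ContinuousOn F (Set.Ioi 0)) (hc : 0 < c)
    (hFc : ∀ z, 0 < z → c ≤ F z) (hκb : 0 < κb) (hb : 0 < b) (hC : 0 < C) (x : ℝ) (hx : 0 < x) :
    let h : ℝ → ℝ := fun w => (1 / b) * Real.exp (-w / b)
    let u : ℝ → ℝ := fun x =>
      (C / x) * Real.exp (-x / b) * Real.exp (κb * ∫ z in (1 : ℝ)..x, F z / z)
    DifferentiableAt ℝ u x ∧
      IntegrableOn (fun z => F z * u z * h (x - z)) (Set.Ioo 0 x) ∧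
      -(deriv (fun t => t * u t) x) =
        -(κb * F x * u x) + κb * ∫ z in (0 : ℝ)..x, F z * u z * h (x - z) := by
  intro h u
  have hq : ContinuousOn (fun z => F z / z) (Set.Ioi 0) :=
    hF.div continuousOn_id (fun z hz => ne_of_gt hz)
  have hsub : ∀ p q : ℝ, 0 < p → 0 < q → Set.uIcc p q ⊆ Set.Ioi 0 := by
    intro p q hp hq z hz
    exact lt_of_lt_of_le (lt_min hp hq) hz.1
  have hint : ∀ p q : ℝ, 0 < p → 0 < q → IntervalIntegrable (fun z => F z / z) volume p q :=
    fun p q hp hq' => (hq.mono (hsub p q hp hq')).intervalIntegrable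
  have hI : ∀ y : ℝ, 0 < y → HasDerivAt (fun y => ∫ z in (1 : ℝ)..y, F z / z) (F y / y) y := by
    intro y hy
    apply integral_hasDerivAt_right (hint 1 y one_pos hy)
    · exact hq.stronglyMeasurableAtFilter isOpen_Ioi y hy
    · exact hq.continuousAt (Ioi_mem_nhds hy)
  let G : ℝ → ℝ := fun y => Real.exp (κb * ∫ z in (1 : ℝ)..y, F z / z)
  have hG : ∀ y : ℝ, 0 < y → HasDerivAt G (G y * (κb * (F y / y))) y := by
    intro y hy
    exact ((hI y hy).const_mul κb).exp
  have hE : ∀ y : ℝ, HasDerivAt (fun y => Real.exp (-y / b)) (Real.exp (-y / b) * (-1 / b)) y := by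
    intro y
    exact (((hasDerivAt_id y).neg).div_const b).exp
  have hGb : ∀ y : ℝ, 0 < y → y ≤ 1 → G y ≤ y ^ (κb * c) := by
    intro y hy hy1
    have h1 : ∫ z in y..1, c * z⁻¹ ≤ ∫ z in y..1, F z / z := by
      apply integral_mono_on hy1 _ (hint y 1 hy one_pos)
      · intro z hz
        have hz0 : 0 < z := lt_of_lt_of_le hy hz.1
        rw [div_eq_mul_inv]
        exact mul_le_mul_of_nonneg_right (hFc z hz0) (inv_nonneg.2 hz0.le)
      · apply ContinuousOn.intervalIntegrable
        apply continuousOn_const.mul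
        apply continuousOn_id.inv₀
        intro z hz
        exact ne_of_gt (hsub y 1 hy one_pos hz)
    rw [intervalIntegral.integral_const_mul, integral_inv_of_pos hy one_pos, one_div,
      Real.log_inv] at h1
    rw [Real.rpow_def_of_pos hy]
    apply Real.exp_le_exp.2
    rw [intervalIntegral.integral_symm]
    nlinarith
  let H : ℝ → ℝ := fun y => if y ≤ 0 then 0 else G y
  have hHG : ∀ y, 0 < y → H y = G y := fun y hy => if_neg (not_le.2 hy)
  have hH0 : H 0 = 0 := if_pos le_rfl
  have hH : ∀ y : ℝ, 0 < y → HasDerivAt H (G y * (κb * (F y / y))) y := by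
    intro y hy
    apply (hG y hy).congr_of_eventuallyEq
    filter_upwards [Ioi_mem_nhds hy] with z hz using hHG z hz
  have hHc : ContinuousOn H (Set.Icc 0 x) := by
    intro y hy
    rcases hy.1.eq_or_lt with h0 | h0
    · subst h0
      apply ContinuousAt.continuousWithinAt
      rw [ContinuousAt, hH0]
      have hp : 0 < κb * c := mul_pos hκb hc
      have ht : Filter.Tendsto (fun y : ℝ => |y| ^ (κb * c)) (nhds 0) (nhds 0) := by
        have : ContinuousAt (fun y : ℝ => |y| ^ (κb * c)) 0 :=
          continuous_abs.continuousAt.rpow_const (Or.inr hp.le)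
        have h2 := this.tendsto
        simpa [Real.zero_rpow hp.ne'] using h2
      apply tendsto_of_tendsto_of_tendsto_of_le_of_le' tendsto_const_nhds ht
      · filter_upwards with z
        by_cases hz : z ≤ 0
        · simp [H, hz]
        · simp only [H, hz, if_false]
          exact (Real.exp_pos _).le
      · filter_upwards [Iio_mem_nhds (one_pos : (0:ℝ) < 1)] with z hz1
        by_cases hz : z ≤ 0
        · simp only [H, hz, if_true]
          positivity
        · have hz' := not_le.1 hz
          rw [hHG z hz', abs_of_pos hz']
          exact hGb z hz' (le_of_lt hz1)
    · exact (hH y h0).continuousAt.continuousWithinAt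
  have hpos : ∀ y ∈ Set.Ioo 0 x, 0 ≤ G y * (κb * (F y / y)) := by
    intro y hy
    have := hFc y hy.1
    have hy0 := hy.1
    have hF0 : 0 < F y := by linarith
    have : 0 < G y := Real.exp_pos _
    positivity
  have hGi : IntegrableOn (fun y => G y * (κb * (F y / y))) (Set.Ioc 0 x) :=
    integrableOn_deriv_of_nonneg hHc (fun y hy => hH y hy.1) hpos
  have hFTC : ∫ y in (0:ℝ)..x, G y * (κb * (F y / y)) = G x := by
    rw [integral_eq_sub_of_hasDerivAt_of_le hx.le hHc (fun y hy => hH y hy.1)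
      ((intervalIntegrable_iff_integrableOn_Ioc_of_le hx.le).2 hGi), hH0, hHG x hx, sub_zero]
  have hfun : (fun z => F z * u z * h (x - z)) =
      fun z => (C / (b * κb) * Real.exp (-x / b)) * (G z * (κb * (F z / z))) := by
    funext z
    have : Real.exp (-x / b) = Real.exp (-z / b) * Real.exp (-(x - z) / b) := by
      rw [← Real.exp_add]; congr 1; ring
    rw [this]
    simp only [u, h, G]
    field_simp
  have hu : u = fun y => C / y * Real.exp (-y / b) * G y := rfl
  refine ⟨?_, ?_, ?_⟩
  · rw [hu]
    exact (((differentiableAt_const C).div differentiableAt_id hx.ne').mul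
      (hE x).differentiableAt).mul (hG x hx).differentiableAt
  · rw [hfun]
    exact (hGi.mono_set Set.Ioo_subset_Ioc_self).const_mul _
  · have hd : HasDerivAt (fun t => t * u t)
        (C * (Real.exp (-x / b) * (-1 / b)) * G x
          + C * Real.exp (-x / b) * (G x * (κb * (F x / x)))) x := by
      apply (((hE x).const_mul C).mul (hG x hx)).congr_of_eventuallyEq
      filter_upwards [Ioi_mem_nhds hx] with z hz
      have hz' : z ≠ 0 := ne_of_gt hz
      simp only [hu, Pi.mul_apply]
      field_simp
    rw [hd.deriv, hfun, intervalIntegral.integral_const_mul, hFTC, hu]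
    field_simp
    ring

/-- The explicit density u_*(x) = (C/x) e^{−x/b} exp(κ_b ∫_1^x F(z)/z dz) is
differentiable on (0, ∞) and satisfies the stationary bursting equation
−(x u_*(x))′ = −κ_b F(x) u_*(x) + κ_b ∫_0^x F(z) u_*(z) h(x − z) dz,
the integral on the right being finite. -/
theorem stationary_density_bursting (Δx Δy κy κb b C : ℝ)
    (hΔx : 1 < Δx) (hΔy : 1 < Δy) (hκy : 0 < κy) (hκb : 0 < κb) (hb : 0 < b) (hC : 0 < C)
    (nx ny : ℕ) (hnx : 1 ≤ nx) (hny : 1 ≤ ny) :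
    let fy : ℝ → ℝ := fun x => (1 + x ^ ny) / (1 + Δy * x ^ ny)
    let F : ℝ → ℝ := fun x => (1 + (κy * fy x) ^ nx) / (1 + Δx * (κy * fy x) ^ nx)
    let h : ℝ → ℝ := fun w => (1 / b) * Real.exp (-w / b)
    let u : ℝ → ℝ := fun x =>
      (C / x) * Real.exp (-x / b) * Real.exp (κb * ∫ z in (1 : ℝ)..x, F z / z)
    ∀ x : ℝ, 0 < x →
      DifferentiableAt ℝ u x ∧
      IntegrableOn (fun z => F z * u z * h (x - z)) (Set.Ioo 0 x) ∧
      -(deriv (fun t => t * u t) x) =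
        -(κb * F x * u x) + κb * ∫ z in (0 : ℝ)..x, F z * u z * h (x - z) := by
  intro fy F h u x hx
  have hfy : ∀ z : ℝ, 0 < z → 0 < fy z := by
    intro z hz
    have : 0 < Δy := by linarith
    simp only [fy]
    positivity
  have hΔ : 0 < Δx := by linarith
  have hfc : ContinuousOn fy (Set.Ioi 0) := by
    apply ContinuousOn.div
    · fun_prop
    · fun_prop
    · intro z hz
      have hz' : (0:ℝ) < z := hz
      have : 0 < Δy := by linarith
      positivity
  apply gen_burst F (1 / Δx) κb b C _ (by positivity) _ hκb hb hC x hx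
  · apply ContinuousOn.div
    · fun_prop
    · fun_prop
    · intro z hz
      have := hfy z hz
      positivity
  · intro z hz
    have := hfy z hz
    have hp : 0 < (κy * fy z) ^ nx := by positivity
    simp only [F]
    rw [div_le_div_iff₀ hΔ (by positivity)]
    nlinarith
end

section
/- Fix real parameters Δ_x, Δ_y > 1, κ_y > 0, κ_b > 0 and an integer n_y ≥ 1, and set n_x = 1, so that F(x) = (1 + κ_y f_y(x))/(1 + Δ_x κ_y f_y(x)) with f_y(x) = (1 + x^{n_y})/(1 + Δ_y x^{n_y}). Let Λ = 1 + Δ_x κ_y, Γ = Δ_y + Δ_x κ_y, A = κ_b(1 + κ_y)/Λ, and θ = κ_b κ_y (Δ_x − 1)(Δ_y − 1)/(n_y Λ Γ). Then for all x > 0: (i) F(x) = ((1 + κ_y) + (Δ_y + κ_y) x^{n_y})/(Λ + Γ x^{n_y}); and (ii) the derivative of x ↦ A log x + θ log(Λ + Γ x^{n_y}) equals κ_b F(x)/x. -/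
open Real

/-- In the monomeric-repression case n_x = 1, the response F has the rational
form F(x) = ((1 + κ_y) + (Δ_y + κ_y) x^{n_y})/(Λ + Γ x^{n_y}), and the function
x ↦ A log x + θ log(Λ + Γ x^{n_y}) has derivative κ_b F(x)/x at every x > 0. -/
theorem monomeric_repression_closed_form (Δx Δy κy κb : ℝ)
    (hΔx : 1 < Δx) (hΔy : 1 < Δy) (hκy : 0 < κy) (hκb : 0 < κb)
    (ny : ℕ) (hny : 1 ≤ ny) :
    let fy : ℝ → ℝ := fun x => (1 + x ^ ny) / (1 + Δy * x ^ ny)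
    let F : ℝ → ℝ := fun x => (1 + κy * fy x) / (1 + Δx * (κy * fy x))
    let Λ : ℝ := 1 + Δx * κy
    let Γ : ℝ := Δy + Δx * κy
    let A : ℝ := κb * (1 + κy) / Λ
    let θ : ℝ := κb * κy * (Δx - 1) * (Δy - 1) / ((ny : ℝ) * Λ * Γ)
    ∀ x : ℝ, 0 < x →
      F x = ((1 + κy) + (Δy + κy) * x ^ ny) / (Λ + Γ * x ^ ny) ∧
      HasDerivAt (fun t : ℝ => A * Real.log t + θ * Real.log (Λ + Γ * t ^ ny))
        (κb * F x / x) x := by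
  intro fy F Λ Γ A θ x hx
  have hX : 0 < x ^ ny := pow_pos hx ny
  have hΔx0 : 0 < Δx := by linarith
  have hΔy0 : 0 < Δy := by linarith
  have hΛ : 0 < Λ := by positivity
  have hΓ : 0 < Γ := by positivity
  have hD : 0 < Λ + Γ * x ^ ny := by positivity
  have hn : (0 : ℝ) < ny := by exact_mod_cast hny
  have hF : F x = ((1 + κy) + (Δy + κy) * x ^ ny) / (Λ + Γ * x ^ ny) := by
    have h1 : 0 < 1 + Δy * x ^ ny := by positivity
    have h2 : 0 < fy x := by
      change 0 < (1 + x ^ ny) / (1 + Δy * x ^ ny)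
      positivity
    have h3 : 0 < 1 + Δx * (κy * fy x) := by positivity
    have h4 : fy x * (1 + Δy * x ^ ny) = 1 + x ^ ny := div_mul_cancel₀ _ h1.ne'
    change (1 + κy * fy x) / (1 + Δx * (κy * fy x)) = _
    rw [div_eq_div_iff h3.ne' hD.ne']
    have e1 : Λ + Γ * x ^ ny = (1 + Δx * (κy * fy x)) * (1 + Δy * x ^ ny) := by
      simp only [Λ, Γ]
      linear_combination (-Δx * κy) * h4
    rw [e1]
    linear_combination (κy * (1 + Δx * (κy * fy x))) * h4
  refine ⟨hF, ?_⟩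
  have hd := ((Real.hasDerivAt_log hx.ne').const_mul A).add
    (((((hasDerivAt_pow ny x).const_mul Γ).const_add Λ).log hD.ne').const_mul θ)
  refine hd.congr_deriv ?_
  rw [hF]
  have hp : x ^ (ny - 1) = x ^ ny / x := by
    rw [eq_div_iff hx.ne', ← pow_succ, Nat.sub_add_cancel hny]
  rw [hp]
  have key : (1 + κy) * Γ + κy * (Δx - 1) * (Δy - 1) = (Δy + κy) * Λ := by
    simp only [Λ, Γ]; ring
  have hA : A = κb * (1 + κy) / Λ := rfl
  have hθ : θ = κb * κy * (Δx - 1) * (Δy - 1) / ((ny : ℝ) * Λ * Γ) := rfl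
  rw [hA, hθ]
  clear_value Λ Γ
  generalize x ^ ny = X at *
  field_simp
  linear_combination X * key
end
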